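/- arXiv:1008.1040 — 2 statements merged into one kernel-verified Lean document; each statement's English description precedes it below -/
import Mathlib

section
/- Let α₁,α₂,α₃,ε ∈ ℝ and let (x₁,x₂,x₃,x̃₁,x̃₂,x̃₃) ∈ ℝ⁶ satisfy the dDC₃ equations x̃₁ − x₁ = ε(x̃₃x₃ − x̃₂x₂ + α₃ − α₂), x̃₂ − x₂ = ε(x̃₁x₁ − x̃₃x₃ + α₁ − α₃), x̃₃ − x₃ = ε(x̃₂x₂ − x̃₁x₁ + α₂ − α₁). Set I₁ = x₁+x₂+x₃, H₂ = x₁³+x₂³+x₃³+3α₁x₁+3α₂x₂+3α₃x₃, G₂ = I₁²x₁x₂x₃ + (α₁x₁+α₂x₂+α₃x₃)(x₁x₂+x₂x₃+x₃x₁) + 2I₁(α₁x₂x₃+α₂x₃x₁+α₃x₁x₂) − (α₂−α₃)²x₁ − (α₃−α₁)²x₂ − (α₁−α₂)²x₃, and D(x) = 1 + ε²(x₁x₂+x₂x₃+x₃x₁). Assume D(x) ≠ 0 and D(x̃) ≠ 0. Then I₁ and H₂(ε) = (H₂ + ε²G₂)/D(x) are conserved quantities: I₁(x̃) = I₁(x)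 and H₂(ε)(x̃) = H₂(ε)(x). -/
/-- `H₂ = x₁³+x₂³+x₃³+3α₁x₁+3α₂x₂+3α₃x₃` for the dressing chain DC₃. -/
noncomputable def dDC3H2 (a1 a2 a3 x1 x2 x3 : ℝ) : ℝ :=
  x1 ^ 3 + x2 ^ 3 + x3 ^ 3 + 3 * a1 * x1 + 3 * a2 * x2 + 3 * a3 * x3

/-- The polynomial `G₂` appearing in the conserved quantity `H₂(ε)` of dDC₃. -/
noncomputable def dDC3G2 (a1 a2 a3 x1 x2 x3 : ℝ) : ℝ :=
  (x1 + x2 + x3) ^ 2 * (x1 * x2 * x3)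
    + (a1 * x1 + a2 * x2 + a3 * x3) * (x1 * x2 + x2 * x3 + x3 * x1)
    + 2 * (x1 + x2 + x3) * (a1 * x2 * x3 + a2 * x3 * x1 + a3 * x1 * x2)
    - (a2 - a3) ^ 2 * x1 - (a3 - a1) ^ 2 * x2 - (a1 - a2) ^ 2 * x3

/-- Denominator `D(x) = 1 + ε²(x₁x₂+x₂x₃+x₃x₁)` of `H₂(ε)` for dDC₃. -/
noncomputable def dDC3D (ε x1 x2 x3 : ℝ) : ℝ :=
  1 + ε ^ 2 * (x1 * x2 + x2 * x3 + x3 * x1)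

/-- Conserved quantities `I₁` and `H₂(ε)` of the Hirota–Kimura discretization
dDC₃ of the three-dimensional dressing chain. -/
theorem dDC3_integrals (a1 a2 a3 ε x1 x2 x3 xt1 xt2 xt3 : ℝ)
    (h1 : xt1 - x1 = ε * (xt3 * x3 - xt2 * x2 + a3 - a2))
    (h2 : xt2 - x2 = ε * (xt1 * x1 - xt3 * x3 + a1 - a3))
    (h3 : xt3 - x3 = ε * (xt2 * x2 - xt1 * x1 + a2 - a1))
    (hD : dDC3D ε x1 x2 x3 ≠ 0)
    (hDt : dDC3D ε xt1 xt2 xt3 ≠ 0) :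
    xt1 + xt2 + xt3 = x1 + x2 + x3 ∧
    (dDC3H2 a1 a2 a3 xt1 xt2 xt3 + ε ^ 2 * dDC3G2 a1 a2 a3 xt1 xt2 xt3)
        / dDC3D ε xt1 xt2 xt3
      = (dDC3H2 a1 a2 a3 x1 x2 x3 + ε ^ 2 * dDC3G2 a1 a2 a3 x1 x2 x3)
        / dDC3D ε x1 x2 x3 := by
  have hI : xt1 + xt2 + xt3 = x1 + x2 + x3 := by linear_combination h1 + h2 + h3
  refine ⟨hI, ?_⟩
  rw [div_eq_div_iff hDt hD]
  rcases eq_or_ne ε 0 with rfl | hε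
  · obtain rfl : xt1 = x1 := by linear_combination h1
    obtain rfl : xt2 = x2 := by linear_combination h2
    obtain rfl : xt3 = x3 := by linear_combination h3
    rfl
  obtain ⟨δ, hδ⟩ : ∃ δ, ε * δ = 1 := ⟨ε⁻¹, mul_inv_cancel₀ hε⟩
  -- The equations determine the parameter differences polynomially.
  obtain rfl : xt3 = x1 + x2 + x3 - xt1 - xt2 := by linear_combination hI
  obtain rfl : a1 = a3 + δ * (xt2 - x2) - xt1 * x1 + (x1 + x2 + x3 - xt1 - xt2) * x3 := by
    linear_combination -δ * h2 - (a1 - a3 + xt1 * x1 - (x1 + x2 + x3 - xt1 - xt2) * x3) * hδ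
  obtain rfl : a2 = a3 - δ * (xt1 - x1) + (x1 + x2 + x3 - xt1 - xt2) * x3 - xt2 * x2 := by
    linear_combination δ * h1 + (a3 - a2 + (x1 + x2 + x3 - xt1 - xt2) * x3 - xt2 * x2) * hδ
  obtain rfl : ε = δ⁻¹ := eq_inv_of_mul_eq_one_left hδ
  have hδ0 : δ ≠ 0 := right_ne_zero_of_mul_eq_one hδ
  simp only [dDC3H2, dDC3G2, dDC3D]
  field_simp
  ring
end

section
/- Let a₁,a₃,b₁,b₃,ε ∈ ℝ and let (m₁,m₂,m₃,p₁,p₂,p₃) and (m̃₁,m̃₂,m̃₃,p̃₁,p̃₂,p̃₃) in ℝ⁶ satisfy the dK equations: m̃₁ − m₁ = ε(a₃−a₁)(m̃₂m₃ + m₂m̃₃) + ε(b₃−b₁)(p̃₂p₃ + p₂p̃₃), m̃₂ − m₂ = ε(a₁−a₃)(m̃₁m₃ + m₁m̃₃) + ε(b₁−b₃)(p̃₁p₃ + p₁p̃₃), m̃₃ = m₃, p̃₁ − p₁ = εa₃(p̃₂m₃ + p₂m̃₃) − εa₁(p̃₃m₂ + p₃m̃₂), p̃₂ − p₂ = εa₁(p̃₃m₁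 + p₃m̃₁) − εa₃(p̃₁m₃ + p₁m̃₃), p̃₃ − p₃ = εa₁(p̃₁m₂ + p₁m̃₂) − εa₁(p̃₂m₁ + p₂m̃₁). Set Δ₀ = a₁ − 2a₃ + ε²a₁²(a₁−a₃)(m₁²+m₂²) + ε²a₁a₃(b₁−b₃)(p₁²+p₂²), Δ₁ = 1 + ε²a₃(a₁−a₃)m₃² + ε²a₁(b₁−b₃)p₃², and γ₃ = Δ₀/(a₁Δ₁). Assume a₁ ≠ 0, Δ₁ ≠ 0 evaluated at both (m,p) and (m̃,p̃). Then (m̃₁p₁ − m₁p̃₁) + (m̃₂p₂ − m₂p̃₂) = γ₃(m̃₃p₃ − m₃p̃₃), and γ₃ is a conserved quantity: γ₃(m̃,p̃) = γ₃(m,p). -/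
/-- The conserved quantity `γ₃ = Δ₀/(a₁Δ₁)` of the Hirota–Kimura discretization
dK of the Kirchhoff case of the rigid body motion in an ideal fluid. -/
noncomputable def dKgamma3 (a1 a3 b1 b3 ε m1 m2 m3 p1 p2 p3 : ℝ) : ℝ :=
  (a1 - 2 * a3 + ε ^ 2 * a1 ^ 2 * (a1 - a3) * (m1 ^ 2 + m2 ^ 2)
      + ε ^ 2 * a1 * a3 * (b1 - b3) * (p1 ^ 2 + p2 ^ 2))
    / (a1 * (1 + ε ^ 2 * a3 * (a1 - a3) * m3 ^ 2
      + ε ^ 2 * a1 * (b1 - b3) * p3 ^ 2))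

/-- Discrete Wronskian relation and conserved quantity `γ₃` for the
Hirota–Kimura discretization dK of the Kirchhoff case. -/
theorem dK_Wronskian_and_gamma3
    (a1 a3 b1 b3 ε m1 m2 m3 p1 p2 p3 mt1 mt2 mt3 pt1 pt2 pt3 : ℝ)
    (hm1 : mt1 - m1 = ε * (a3 - a1) * (mt2 * m3 + m2 * mt3)
          + ε * (b3 - b1) * (pt2 * p3 + p2 * pt3))
    (hm2 : mt2 - m2 = ε * (a1 - a3) * (mt1 * m3 + m1 * mt3)
          + ε * (b1 - b3) * (pt1 * p3 + p1 * pt3))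
    (hm3 : mt3 = m3)
    (hp1 : pt1 - p1 = ε * a3 * (pt2 * m3 + p2 * mt3)
          - ε * a1 * (pt3 * m2 + p3 * mt2))
    (hp2 : pt2 - p2 = ε * a1 * (pt3 * m1 + p3 * mt1)
          - ε * a3 * (pt1 * m3 + p1 * mt3))
    (hp3 : pt3 - p3 = ε * a1 * (pt1 * m2 + p1 * mt2)
          - ε * a1 * (pt2 * m1 + p2 * mt1))
    (ha1 : a1 ≠ 0)
    (hΔ : 1 + ε ^ 2 * a3 * (a1 - a3) * m3 ^ 2
          + ε ^ 2 * a1 * (b1 - b3) * p3 ^ 2 ≠ 0)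
    (hΔt : 1 + ε ^ 2 * a3 * (a1 - a3) * mt3 ^ 2
          + ε ^ 2 * a1 * (b1 - b3) * pt3 ^ 2 ≠ 0) :
    (mt1 * p1 - m1 * pt1) + (mt2 * p2 - m2 * pt2)
        = dKgamma3 a1 a3 b1 b3 ε m1 m2 m3 p1 p2 p3 * (mt3 * p3 - m3 * pt3) ∧
    dKgamma3 a1 a3 b1 b3 ε mt1 mt2 mt3 pt1 pt2 pt3
        = dKgamma3 a1 a3 b1 b3 ε m1 m2 m3 p1 p2 p3 := by
  subst hm3
  have hW : a1 * (1 + ε ^ 2 * a3 * (a1 - a3) * mt3 ^ 2 + ε ^ 2 * a1 * (b1 - b3) * p3 ^ 2)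
        * ((mt1 * p1 - m1 * pt1) + (mt2 * p2 - m2 * pt2))
      = (a1 - 2 * a3 + ε ^ 2 * a1 ^ 2 * (a1 - a3) * (m1 ^ 2 + m2 ^ 2)
        + ε ^ 2 * a1 * a3 * (b1 - b3) * (p1 ^ 2 + p2 ^ 2)) * (mt3 * p3 - mt3 * pt3) := by
    linear_combination
      a1 * ((p1 + ε * a3 * mt3 * p2 - ε * a1 * p3 * m2) * hm1
        - (-p2 + ε * a3 * mt3 * p1 - ε * a1 * p3 * m1) * hm2
        + (ε * (b1 - b3) * p3 * p2 - m1 + ε * (a1 - a3) * mt3 * m2) * hp1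
        - (ε * (b1 - b3) * p3 * p1 + m2 + ε * (a1 - a3) * mt3 * m1) * hp2)
      - mt3 * (2 * a3 - a1) * hp3
  have hγ : (a1 - 2 * a3 + ε ^ 2 * a1 ^ 2 * (a1 - a3) * (m1 ^ 2 + m2 ^ 2)
        + ε ^ 2 * a1 * a3 * (b1 - b3) * (p1 ^ 2 + p2 ^ 2))
        * (1 + ε ^ 2 * a3 * (a1 - a3) * mt3 ^ 2 + ε ^ 2 * a1 * (b1 - b3) * pt3 ^ 2)
      = (a1 - 2 * a3 + ε ^ 2 * a1 ^ 2 * (a1 - a3) * (mt1 ^ 2 + mt2 ^ 2)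
        + ε ^ 2 * a1 * a3 * (b1 - b3) * (pt1 ^ 2 + pt2 ^ 2))
        * (1 + ε ^ 2 * a3 * (a1 - a3) * mt3 ^ 2 + ε ^ 2 * a1 * (b1 - b3) * p3 ^ 2) := by
    linear_combination
      ε ^ 2 * a1 * (
        (-a1 * (a1 - a3) * (mt1 + m1) + ε * a1 * a3 * (b1 - b3) * ((pt3 - p3) / 2) * (pt2 + p2)
          - ε * a1 * a3 * (a1 - a3) * mt3 * (mt2 - m2)
          - ε * a1 * a3 * (b1 - b3) * ((pt3 + p3) / 2) * (pt2 - p2)) * hm1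
        - (a1 * (a1 - a3) * (mt2 + m2) + ε * a1 * a3 * (b1 - b3) * ((pt3 - p3) / 2) * (pt1 + p1)
          - ε * a1 * a3 * (a1 - a3) * mt3 * (mt1 - m1)
          - ε * a1 * a3 * (b1 - b3) * ((pt3 + p3) / 2) * (pt1 - p1)) * hm2
        + (ε * a1 * (a1 - a3) * (b1 - b3) * ((pt3 - p3) / 2) * (mt2 + m2)
          - a3 * (b1 - b3) * (pt1 + p1)
          - ε * a1 * (a1 - a3) * (b1 - b3) * ((pt3 + p3) / 2) * (mt2 - m2)
          + ε * a3 * (a1 - a3) * (b1 - b3) * mt3 * (pt2 - p2)) * hp1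
        - (ε * a1 * (a1 - a3) * (b1 - b3) * ((pt3 - p3) / 2) * (mt1 + m1)
          + a3 * (b1 - b3) * (pt2 + p2)
          - ε * a1 * (a1 - a3) * (b1 - b3) * ((pt3 + p3) / 2) * (mt1 - m1)
          + ε * a3 * (a1 - a3) * (b1 - b3) * mt3 * (pt1 - p1)) * hp2)
      + (a1 - 2 * a3) * ε ^ 2 * a1 * (b1 - b3) * (pt3 + p3) * hp3
  constructor
  · rw [dKgamma3, div_mul_eq_mul_div, eq_div_iff (mul_ne_zero ha1 hΔ)]
    linear_combination hW
  · rw [dKgamma3, dKgamma3, div_eq_div_iff (mul_ne_zero ha1 hΔt) (mul_ne_zero ha1 hΔ)]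
    linear_combination -a1 * hγ
end
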